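/- Suppose w is conservative and generic, t is incident to exactly one edge of G, and let uv ∈ E*, i.e. uv ∉ E(P_u) Δ E(P_v) and ζ(uv) = ζ*. Then there exist a vertex c and a path R from c to t such that: P_u and P_v both have R as their terminal segment (suffix); E(P_u) ∩ E(P_v) with the edge uv removed equals E(R); and the edge set (E(P_u) Δ E(P_v)) ∪ {uv} is the edge set of a cycle C of G passing through c with V(C) ∩ V(R) = {c}. -/

import Mathlib

open SimpleGraph

/-- Weight of a walk: sum of the weights of its edges. -/
noncomputable def walkWeight {V : Type*} {G : SimpleGraph V} (w : Sym2 V → ℝ)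
    {x y : V} (p : G.Walk x y) : ℝ :=
  (p.edges.map w).sum

/-- `w` is conservative: every cycle of `G` has nonnegative total weight. -/
def Conservative {V : Type*} (G : SimpleGraph V) (w : Sym2 V → ℝ) : Prop :=
  ∀ (v : V) (c : G.Walk v v), c.IsCycle → 0 ≤ walkWeight w c

/-- `w` is generic: distinct subsets of `E(G)` have distinct total weights. -/
def Generic {V : Type*} (G : SimpleGraph V) (w : Sym2 V → ℝ) : Prop :=
  ∀ A B : Finset (Sym2 V), (∀ e ∈ A, e ∈ G.edgeSet) → (∀ e ∈ B, e ∈ G.edgeSet) →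
    (∑ e ∈ A, w e) = (∑ e ∈ B, w e) → A = B

/-- `ζ(uv)`: `w(P_u) + w(P_v) + w(uv)` if `uv ∉ E(P_u) ∩ E(P_v)`, and
`w(P_u) + w(P_v) − w(uv)` if `uv ∈ E(P_u) ∩ E(P_v)`. -/
noncomputable def zeta {V : Type*} [DecidableEq V] {G : SimpleGraph V} {t : V}
    (w : Sym2 V → ℝ) (P : ∀ v : V, G.Walk v t) (u v : V) : ℝ :=
  if s(u, v) ∈ (P u).edges ∧ s(u, v) ∈ (P v).edges then
    walkWeight w (P u) + walkWeight w (P v) - w s(u, v)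
  else
    walkWeight w (P u) + walkWeight w (P v) + w s(u, v)

/-- `uv ∉ E(P_u) Δ E(P_v)`. -/
def NotInSymmDiff {V : Type*} {G : SimpleGraph V} {t : V}
    (P : ∀ v : V, G.Walk v t) (u v : V) : Prop :=
  s(u, v) ∈ (P u).edges ↔ s(u, v) ∈ (P v).edges

/-- `ζ* = min { ζ(uv) : uv ∈ E(G), uv ∉ E(P_u) Δ E(P_v) }`. -/
noncomputable def zetaStar {V : Type*} [DecidableEq V] (G : SimpleGraph V) (t : V)
    (w : Sym2 V → ℝ) (P : ∀ v : V, G.Walk v t) : ℝ :=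
  sInf {z : ℝ | ∃ u v : V, G.Adj u v ∧ NotInSymmDiff P u v ∧ z = zeta w P u v}

/-- `E*`: the set of edges attaining the minimum `ζ*`. -/
def EStar {V : Type*} [DecidableEq V] (G : SimpleGraph V) (t : V)
    (w : Sym2 V → ℝ) (P : ∀ v : V, G.Walk v t) : Set (Sym2 V) :=
  {e | ∃ u v : V, e = s(u, v) ∧ G.Adj u v ∧ NotInSymmDiff P u v ∧
        zeta w P u v = zetaStar G t w P}

open scoped symmDiff

/-- The degree of each vertex in the edge set `F`, modulo two. -/
def parity {V : Type*} [DecidableEq V] (F : Finset (Sym2 V)) : V → ZMod 2 :=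
  fun x => ∑ e ∈ F, if x ∈ e then 1 else 0

theorem zmodTwo_add_self {V : Type*} (f : V → ZMod 2) : f + f = 0 := by
  funext x; exact CharTwo.add_self_eq_zero _

section Joins

variable {V : Type*} [DecidableEq V] {G : SimpleGraph V} {w : Sym2 V → ℝ}

theorem sum_symmDiff_add {M : Type*} [AddCommMonoid M] (f : Sym2 V → M) (A B : Finset (Sym2 V)) :
    ∑ e ∈ A ∆ B, f e + 2 • ∑ e ∈ A ∩ B, f e = ∑ e ∈ A, f e + ∑ e ∈ B, f e := by
  have hd : Disjoint (A \ B) (B \ A) := disjoint_sdiff_sdiff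
  have h1 : ∑ e ∈ A ∆ B, f e = ∑ e ∈ A \ B, f e + ∑ e ∈ B \ A, f e := by
    rw [← Finset.sum_union hd]; rfl
  have h2 := Finset.sum_inter_add_sum_sdiff A B f
  have h3 := Finset.sum_inter_add_sum_sdiff B A f
  rw [Finset.inter_comm] at h3
  rw [h1, ← h2, ← h3, two_nsmul]
  abel

theorem parity_symmDiff (A B : Finset (Sym2 V)) : parity (A ∆ B) = parity A + parity B := by
  funext x
  have h := sum_symmDiff_add (fun e => if x ∈ e then (1 : ZMod 2) else 0) A B
  rw [CharTwo.two_nsmul, add_zero] at h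
  exact h

theorem parity_empty : parity (∅ : Finset (Sym2 V)) = 0 := by
  funext x; simp [parity]

theorem parity_singleton {x y : V} (h : x ≠ y) :
    parity {s(x, y)} = Pi.single x 1 + Pi.single y 1 := by
  funext z
  simp only [parity, Finset.sum_singleton, Sym2.mem_iff, Pi.add_apply, Pi.single_apply]
  by_cases h1 : z = x
  · subst h1; simp [h]
  · simp [h1]

theorem parity_sdiff {A B : Finset (Sym2 V)} (h : B ⊆ A) :
    parity (A \ B) = parity A + parity B := by
  rw [← parity_symmDiff, symmDiff_of_ge h]

theorem parity_edges {x y : V} (p : G.Walk x y) (hp : p.IsTrail) :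
    parity p.edges.toFinset = Pi.single x 1 + Pi.single y 1 := by
  induction p with
  | nil => rw [zmodTwo_add_self]; simp [parity_empty]
  | @cons a b c h p ih =>
    rw [Walk.isTrail_cons] at hp
    have hs : (Walk.cons h p).edges.toFinset = {s(a, b)} ∆ p.edges.toFinset := by
      ext e
      simp only [Walk.edges_cons, List.toFinset_cons, Finset.mem_insert, Finset.mem_symmDiff,
        Finset.mem_singleton, List.mem_toFinset]
      constructor
      · rintro (rfl | he)
        · exact Or.inl ⟨rfl, hp.2⟩
        · exact Or.inr ⟨he, fun h => hp.2 (h ▸ he)⟩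
      · tauto
    rw [hs, parity_symmDiff, parity_singleton h.ne, ih hp.1]
    have := zmodTwo_add_self (Pi.single b 1 : V → ZMod 2)
    linear_combination this

theorem walkWeight_eq_sum {x y : V} (p : G.Walk x y) (hp : p.IsTrail) :
    walkWeight w p = ∑ e ∈ p.edges.toFinset, w e :=
  (List.sum_toFinset w hp.edges_nodup).symm

theorem mem_edgeSet_of_mem_toFinset_edges {x y : V} (p : G.Walk x y) :
    ∀ e ∈ p.edges.toFinset, e ∈ G.edgeSet := fun _ he =>
  p.edges_subset_edgeSet (List.mem_toFinset.1 he)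

theorem exists_walk_of_parity (t : V) (F : Finset (Sym2 V)) :
    ∀ x : V, (∀ e ∈ F, e ∈ G.edgeSet) → parity F = Pi.single x 1 + Pi.single t 1 →
      ∃ p : G.Walk x t, ∀ e ∈ p.edges, e ∈ F := by
  induction F using Finset.strongInduction with
  | H F ih =>
    intro x hF hpar
    by_cases hx : x = t
    · subst hx; exact ⟨Walk.nil, by simp⟩
    have h1 : parity F x = 1 := by
      rw [hpar]; simp [hx]
    obtain ⟨e, he, hxe⟩ : ∃ e ∈ F, x ∈ e := by
      by_contra! hne
      rw [parity, Finset.sum_eq_zero (fun e he => if_neg (hne e he))] at h1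
      exact zero_ne_one h1
    obtain ⟨y, rfl⟩ := hxe
    have hadj : G.Adj x y := hF _ he
    have hsub : {s(x, y)} ⊆ F := Finset.singleton_subset_iff.2 he
    have hlt : F \ {s(x, y)} ⊂ F := Finset.sdiff_ssubset hsub (Finset.singleton_nonempty _)
    obtain ⟨p, hp⟩ := ih _ hlt y (fun e he => hF e (hlt.1 he)) (by
      rw [parity_sdiff hsub, hpar, parity_singleton hadj.ne]
      have := zmodTwo_add_self (Pi.single x 1 : V → ZMod 2)
      linear_combination this)
    refine ⟨Walk.cons hadj p, fun e h => ?_⟩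
    rw [Walk.edges_cons, List.mem_cons] at h
    rcases h with rfl | h
    · exact he
    · exact hlt.1 (hp e h)

theorem exists_path_of_parity {t x : V} {F : Finset (Sym2 V)} (hF : ∀ e ∈ F, e ∈ G.edgeSet)
    (hpar : parity F = Pi.single x 1 + Pi.single t 1) :
    ∃ p : G.Walk x t, p.IsPath ∧ p.edges.toFinset ⊆ F := by
  obtain ⟨p, hp⟩ := exists_walk_of_parity t F x hF hpar
  exact ⟨p.bypass, p.bypass_isPath, fun e he =>
    hp e (p.edges_bypass_subset_edges (List.mem_toFinset.1 he))⟩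

theorem exists_cycle_of_parity {x y : V} {F : Finset (Sym2 V)} (hF : ∀ e ∈ F, e ∈ G.edgeSet)
    (hpar : parity F = 0) (he : s(x, y) ∈ F) :
    ∃ C : G.Walk x x, C.IsCycle ∧ s(x, y) ∈ C.edges ∧ C.edges.toFinset ⊆ F := by
  have hadj : G.Adj x y := hF _ he
  have hsub : {s(x, y)} ⊆ F := Finset.singleton_subset_iff.2 he
  obtain ⟨p, hp, hpF⟩ := exists_path_of_parity (G := G) (x := y) (t := x) (F := F \ {s(x, y)})
    (fun e he => hF e (Finset.sdiff_subset he)) (by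
      rw [parity_sdiff hsub, hpar, parity_singleton hadj.ne, zero_add, add_comm])
  refine ⟨Walk.cons hadj p, ?_, by simp, ?_⟩
  · rw [Walk.cons_isCycle_iff]
    refine ⟨hp, fun h => ?_⟩
    have := hpF (List.mem_toFinset.2 h)
    simp at this
  · intro e h
    rw [Walk.edges_cons, List.toFinset_cons, Finset.mem_insert] at h
    rcases h with rfl | h
    · exact he
    · exact Finset.sdiff_subset (hpF h)

theorem Conservative.sum_nonneg (hcons : Conservative G w) (F : Finset (Sym2 V))
    (hF : ∀ e ∈ F, e ∈ G.edgeSet) (hpar : parity F = 0) : 0 ≤ ∑ e ∈ F, w e := by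
  induction F using Finset.strongInduction with
  | H F ih =>
    rcases F.eq_empty_or_nonempty with rfl | ⟨e, he⟩
    · simp
    induction e using Sym2.ind with
    | h x y =>
      obtain ⟨C, hC, heC, hCF⟩ := exists_cycle_of_parity hF hpar he
      have hlt : F \ C.edges.toFinset ⊂ F :=
        Finset.sdiff_ssubset hCF ⟨_, List.mem_toFinset.2 heC⟩
      have h1 := ih _ hlt (fun e he => hF e (hlt.1 he)) (by
        rw [parity_sdiff hCF, hpar, parity_edges C hC.isTrail, zmodTwo_add_self, zero_add])
      have h2 := hcons x C hC
      rw [walkWeight_eq_sum C hC.isTrail] at h2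
      rw [← Finset.sum_sdiff hCF]
      exact add_nonneg h1 h2

/-- A shortest path is the lightest edge set of its boundary. -/
theorem Conservative.sum_edges_le (hcons : Conservative G w) {x t : V} {p : G.Walk x t}
    (hp : p.IsPath) (hmin : ∀ q : G.Walk x t, q.IsPath → walkWeight w p ≤ walkWeight w q)
    {F : Finset (Sym2 V)} (hF : ∀ e ∈ F, e ∈ G.edgeSet)
    (hpar : parity F = Pi.single x 1 + Pi.single t 1) :
    ∑ e ∈ p.edges.toFinset, w e ≤ ∑ e ∈ F, w e := by
  obtain ⟨q, hq, hqF⟩ := exists_path_of_parity hF hpar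
  have h1 := hcons.sum_nonneg (F \ q.edges.toFinset) (fun e he => hF e (Finset.sdiff_subset he))
    (by rw [parity_sdiff hqF, hpar, parity_edges q hq.isTrail, zmodTwo_add_self])
  have h2 := hmin q hq
  rw [walkWeight_eq_sum p hp.isTrail, walkWeight_eq_sum q hq.isTrail] at h2
  rw [← Finset.sum_sdiff hqF]
  linarith

end Joins

section Walks

variable {V : Type*} {G : SimpleGraph V}

theorem exists_suffix_meeting_once (S : Set V) {a b : V} (p : G.Walk a b)
    (h : ∃ z ∈ p.support, z ∈ S) :
    ∃ (c : V) (q : G.Walk a c) (r : G.Walk c b), p = q.append r ∧ c ∈ S ∧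
      ∀ z ∈ r.support, z ∈ S → z = c := by
  induction p with
  | nil =>
    obtain ⟨z, hz, hS⟩ := h
    rw [Walk.support_nil, List.mem_singleton] at hz
    subst hz
    exact ⟨z, Walk.nil, Walk.nil, rfl, hS, by simp⟩
  | @cons a b t hab p ih =>
    by_cases hp : ∃ z ∈ p.support, z ∈ S
    · obtain ⟨c, q, r, rfl, hc, hr⟩ := ih hp
      exact ⟨c, Walk.cons hab q, r, rfl, hc, hr⟩
    · obtain ⟨z, hz, hS⟩ := h
      push Not at hp
      rw [Walk.support_cons, List.mem_cons] at hz
      rcases hz with rfl | hz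
      · refine ⟨z, Walk.nil, Walk.cons hab p, rfl, hS, fun y hy hyS => ?_⟩
        rw [Walk.support_cons, List.mem_cons] at hy
        exact hy.resolve_right fun h => hp y h hyS
      · exact absurd hS (hp z hz)

theorem SimpleGraph.Walk.IsPath.eq_of_mem_edges_iff {a b : V} {p q : G.Walk a b} (hp : p.IsPath)
    (hq : q.IsPath) (h : ∀ e, e ∈ p.edges ↔ e ∈ q.edges) : p = q := by
  induction p with
  | nil => exact (Walk.isPath_iff_nil.1 hq).eq_nil.symm
  | @cons a b t hab p ih =>
    rw [Walk.cons_isPath_iff] at hp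
    cases q with
    | nil => exact absurd p.end_mem_support hp.2
    | @cons _ d _ had q =>
      rw [Walk.cons_isPath_iff] at hq
      have hbd : b = d := by
        have := (h s(a, b)).1 (by simp)
        rw [Walk.edges_cons, List.mem_cons] at this
        rcases this with h1 | h1
        · rwa [Sym2.congr_right] at h1
        · exact absurd (q.fst_mem_support_of_mem_edges h1) hq.2
      subst hbd
      have hpe : s(a, b) ∉ p.edges := fun h => hp.2 (p.fst_mem_support_of_mem_edges h)
      have hqe : s(a, b) ∉ q.edges := fun h => hq.2 (q.fst_mem_support_of_mem_edges h)
      rw [ih hp.1 hq.1]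
      intro e
      have := h e
      rw [Walk.edges_cons, Walk.edges_cons, List.mem_cons, List.mem_cons] at this
      by_cases he : e = s(a, b)
      · subst he; simp [hpe, hqe]
      · simpa [he] using this

end Walks

section Zeta

variable {V : Type*} [DecidableEq V] {G : SimpleGraph V} {w : Sym2 V → ℝ}

theorem sum_symmDiff_add_sum_symmDiff {A B K : Finset (Sym2 V)} (hK : K ⊆ A ∆ B) :
    ∑ e ∈ A ∆ K, w e + ∑ e ∈ B ∆ K, w e = ∑ e ∈ A, w e + ∑ e ∈ B, w e := by
  have hu : A ∆ K ∪ B ∆ K = A ∪ B := by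
    ext e
    have := @hK e
    simp only [Finset.mem_union, Finset.mem_symmDiff] at *
    tauto
  have hi : A ∆ K ∩ B ∆ K = A ∩ B := by
    ext e
    have := @hK e
    simp only [Finset.mem_inter, Finset.mem_symmDiff] at *
    tauto
  rw [← Finset.sum_union_inter, ← Finset.sum_union_inter (s₁ := A), hu, hi]

theorem sum_symmDiff_singleton_add {A B : Finset (Sym2 V)} {e : Sym2 V} (he : e ∈ A ↔ e ∈ B) :
    ∑ f ∈ {e} ∆ (A ∆ B), w f + 2 * ∑ f ∈ (A ∩ B).erase e, w f =
      ∑ f ∈ A, w f + ∑ f ∈ B, w f + if e ∈ A ∧ e ∈ B then - w e else w e := by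
  have hd : e ∉ A ∆ B := by rw [Finset.mem_symmDiff]; tauto
  have h1 := sum_symmDiff_add w A B
  have h2 := sum_symmDiff_add w {e} (A ∆ B)
  rw [Finset.singleton_inter_of_notMem hd, Finset.sum_empty, Finset.sum_singleton] at h2
  rw [two_nsmul] at h1
  simp only [smul_zero] at h2
  by_cases h : e ∈ A ∧ e ∈ B
  · have h3 := Finset.sum_erase_add (A ∩ B) w (Finset.mem_inter.2 h)
    rw [if_pos h]
    linarith
  · rw [if_neg h, Finset.erase_eq_of_notMem (fun h' => h (Finset.mem_inter.1 h'))]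
    linarith

theorem zeta_eq {t : V} {P : ∀ v : V, G.Walk v t} (hP : ∀ v, (P v).IsPath) (x y : V) :
    zeta w P x y = ∑ f ∈ (P x).edges.toFinset, w f + ∑ f ∈ (P y).edges.toFinset, w f +
      if s(x, y) ∈ (P x).edges.toFinset ∧ s(x, y) ∈ (P y).edges.toFinset
        then - w s(x, y) else w s(x, y) := by
  simp only [zeta, walkWeight_eq_sum _ (hP _).isTrail, List.mem_toFinset]
  split_ifs
  · ring
  · rfl

theorem zetaStar_le [Finite V] {t : V} {P : ∀ v : V, G.Walk v t} {x y : V} (h : G.Adj x y)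
    (hn : NotInSymmDiff P x y) : zetaStar G t w P ≤ zeta w P x y := by
  refine csInf_le (Set.Finite.bddBelow ?_) ⟨x, y, h, hn, rfl⟩
  refine (Set.finite_range fun q : V × V => zeta w P q.1 q.2).subset ?_
  rintro _ ⟨a, b, -, -, rfl⟩
  exact ⟨(a, b), rfl⟩

end Zeta

section ShortestPaths

variable {V : Type*} [DecidableEq V] {G : SimpleGraph V} {w : Sym2 V → ℝ} {t : V}
  {P : ∀ v : V, G.Walk v t}

theorem edges_eq_of_sum_le (hcons : Conservative G w) (hgen : Generic G w)
    (hPpath : ∀ v, (P v).IsPath)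
    (hPmin : ∀ (v : V) (Q : G.Walk v t), Q.IsPath → walkWeight w (P v) ≤ walkWeight w Q)
    {x : V} {F : Finset (Sym2 V)} (hF : ∀ e ∈ F, e ∈ G.edgeSet)
    (hpar : parity F = Pi.single x 1 + Pi.single t 1)
    (hle : ∑ e ∈ F, w e ≤ ∑ e ∈ (P x).edges.toFinset, w e) : (P x).edges.toFinset = F :=
  hgen _ _ (mem_edgeSet_of_mem_toFinset_edges _) hF
    (le_antisymm (hcons.sum_edges_le (hPpath x) (hPmin x) hF hpar) hle)

/-- Exchanging `K` between two shortest paths costs nothing in total, so if it preserves the two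
boundaries up to swapping, it yields the shortest paths again. -/
theorem edges_eq_symmDiff (hcons : Conservative G w) (hgen : Generic G w)
    (hPpath : ∀ v, (P v).IsPath)
    (hPmin : ∀ (v : V) (Q : G.Walk v t), Q.IsPath → walkWeight w (P v) ≤ walkWeight w Q)
    {x y x' y' : V} {K : Finset (Sym2 V)} (hK : ∀ e ∈ K, e ∈ G.edgeSet)
    (hsub : K ⊆ (P x).edges.toFinset ∆ (P y).edges.toFinset)
    (hx : parity K = Pi.single x 1 + Pi.single x' 1)
    (hy : parity K = Pi.single y 1 + Pi.single y' 1)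
    (hxy : x' = x ∧ y' = y ∨ x' = y ∧ y' = x) :
    (P x').edges.toFinset = (P x).edges.toFinset ∆ K := by
  have hG : ∀ z, ∀ e ∈ (P z).edges.toFinset ∆ K, e ∈ G.edgeSet := by
    intro z e he
    rw [Finset.mem_symmDiff] at he
    rcases he with he | he
    · exact mem_edgeSet_of_mem_toFinset_edges _ e he.1
    · exact hK e he.1
  have hpar : ∀ z z', parity K = Pi.single z 1 + Pi.single z' 1 →
      parity ((P z).edges.toFinset ∆ K) = Pi.single z' 1 + Pi.single t 1 := by
    intro z z' hz
    rw [parity_symmDiff, parity_edges _ (hPpath z).isTrail, hz]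
    have := zmodTwo_add_self (Pi.single z 1 : V → ZMod 2)
    linear_combination this
  have hsum := sum_symmDiff_add_sum_symmDiff (w := w) hsub
  have hy' := hcons.sum_edges_le (hPpath y') (hPmin y') (hG y) (hpar y y' hy)
  refine edges_eq_of_sum_le hcons hgen hPpath hPmin (hG x) (hpar x x' hx) ?_
  rcases hxy with ⟨rfl, rfl⟩ | ⟨rfl, rfl⟩ <;> linarith

/-- An edge at which the symmetric difference is nontrivial closes it up to a single cycle. -/
theorem exists_cycle_edges_eq (hcons : Conservative G w) (hgen : Generic G w)
    (hPpath : ∀ v, (P v).IsPath)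
    (hPmin : ∀ (v : V) (Q : G.Walk v t), Q.IsPath → walkWeight w (P v) ≤ walkWeight w Q)
    {u v : V} (huv : G.Adj u v) (hnd : NotInSymmDiff P u v) :
    ∃ C : G.Walk u u, C.IsCycle ∧ C.edges.toFinset =
      {s(u, v)} ∆ ((P u).edges.toFinset ∆ (P v).edges.toFinset) := by
  set D := {s(u, v)} ∆ ((P u).edges.toFinset ∆ (P v).edges.toFinset) with hD
  have hmem : s(u, v) ∉ (P u).edges.toFinset ∆ (P v).edges.toFinset := by
    simp only [Finset.mem_symmDiff, List.mem_toFinset]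
    have : s(u, v) ∈ (P u).edges ↔ s(u, v) ∈ (P v).edges := hnd
    tauto
  have hDG : ∀ e ∈ D, e ∈ G.edgeSet := by
    intro e he
    simp only [hD, Finset.mem_symmDiff, Finset.mem_singleton] at he
    rcases he with ⟨rfl, -⟩ | ⟨he | he, -⟩
    · exact huv
    · exact mem_edgeSet_of_mem_toFinset_edges _ e he.1
    · exact mem_edgeSet_of_mem_toFinset_edges _ e he.1
  have hDpar : parity D = 0 := by
    rw [hD, parity_symmDiff, parity_symmDiff, parity_singleton huv.ne,
      parity_edges _ (hPpath u).isTrail, parity_edges _ (hPpath v).isTrail]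
    have h1 := zmodTwo_add_self (Pi.single u 1 : V → ZMod 2)
    have h2 := zmodTwo_add_self (Pi.single v 1 : V → ZMod 2)
    have h3 := zmodTwo_add_self (Pi.single t 1 : V → ZMod 2)
    linear_combination h1 + h2 + h3
  have heD : s(u, v) ∈ D := by
    rw [hD, Finset.mem_symmDiff]; exact Or.inl ⟨Finset.mem_singleton_self _, hmem⟩
  obtain ⟨C, hC, heC, hCD⟩ := exists_cycle_of_parity hDG hDpar heD
  refine ⟨C, hC, hCD.antisymm ?_⟩
  have hKpar : parity (D \ C.edges.toFinset) = 0 := by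
    rw [parity_sdiff hCD, hDpar, parity_edges C hC.isTrail, zmodTwo_add_self, zero_add]
  have hK := edges_eq_symmDiff hcons hgen hPpath hPmin (x := u) (y := v) (x' := u) (y' := v)
    (K := D \ C.edges.toFinset)
    (fun e he => hDG e (Finset.sdiff_subset he)) (by
      intro e he
      rw [Finset.mem_sdiff, hD, Finset.mem_symmDiff, Finset.mem_singleton, List.mem_toFinset] at he
      rcases he with ⟨⟨rfl, -⟩ | ⟨he, -⟩, h⟩
      · exact absurd heC h
      · exact he)
    (by rw [hKpar, zmodTwo_add_self]) (by rw [hKpar, zmodTwo_add_self]) (Or.inl ⟨rfl, rfl⟩)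
  rw [eq_comm, symmDiff_eq_left] at hK
  exact Finset.sdiff_eq_empty_iff_subset.1 hK

/-- Off the symmetric difference closed up by an optimal edge, all shortest paths from its
vertices agree. -/
theorem mem_edges_iff_of_mem_support [Finite V] (hcons : Conservative G w) (hgen : Generic G w)
    (hPpath : ∀ v, (P v).IsPath)
    (hPmin : ∀ (v : V) (Q : G.Walk v t), Q.IsPath → walkWeight w (P v) ≤ walkWeight w Q)
    {u v : V} (hnd : NotInSymmDiff P u v)
    (hmin : zeta w P u v = zetaStar G t w P) {D I : Finset (Sym2 V)}
    (hD : D = {s(u, v)} ∆ ((P u).edges.toFinset ∆ (P v).edges.toFinset))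
    (hDG : ∀ e ∈ D, e ∈ G.edgeSet) (hDpar : parity D = 0)
    (hI : I = ((P u).edges.toFinset ∩ (P v).edges.toFinset).erase s(u, v)) {x z : V}
    (p : G.Walk x z) (hp : ∀ e ∈ p.edges, e ∈ D)
    (hx : ∀ e ∉ D, e ∈ (P x).edges.toFinset ↔ e ∈ I) :
    ∀ y ∈ p.support, ∀ e ∉ D, e ∈ (P y).edges.toFinset ↔ e ∈ I := by
  have hID : ∀ f ∈ D, f ∉ I := by
    intro f
    rw [hI, hD]
    simp only [Finset.mem_erase, Finset.mem_inter, Finset.mem_symmDiff, Finset.mem_singleton]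
    tauto
  induction p with
  | nil =>
    intro y hy
    rw [Walk.support_nil, List.mem_singleton] at hy
    subst hy
    exact hx
  | @cons x y z hxy p ih =>
    intro y' hy'
    rw [Walk.support_cons, List.mem_cons] at hy'
    rcases hy' with rfl | hy'
    · exact hx
    refine ih (fun e he => hp e (by simp [he])) ?_ y' hy'
    have heD : s(x, y) ∈ D := hp _ (by simp)
    have hpe := parity_singleton hxy.ne
    by_cases hxyn : NotInSymmDiff P x y
    · have hnxy : s(x, y) ∈ (P x).edges.toFinset ↔ s(x, y) ∈ (P y).edges.toFinset := by
        simpa only [List.mem_toFinset, NotInSymmDiff] using hxyn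
      have hnuv : s(u, v) ∈ (P u).edges.toFinset ↔ s(u, v) ∈ (P v).edges.toFinset := by
        simpa only [List.mem_toFinset, NotInSymmDiff] using hnd
      set B := {s(x, y)} ∆ ((P x).edges.toFinset ∆ D) with hB
      have hBmem : s(x, y) ∈ (P x).edges.toFinset ↔ s(x, y) ∈ B := by
        simp only [hB, Finset.mem_symmDiff, Finset.mem_singleton, heD]
        by_cases h : s(x, y) ∈ (P x).edges.toFinset <;> simp [h]
      have hBne : ∀ f, f ≠ s(x, y) → (f ∈ B ↔ (f ∈ (P x).edges.toFinset ↔ f ∉ D)) := by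
        intro f hf
        simp only [hB, Finset.mem_symmDiff, Finset.mem_singleton, hf]
        by_cases h : f ∈ (P x).edges.toFinset <;> simp [h]
      have hle := zetaStar_le (w := w) hxy hxyn
      rw [← hmin, zeta_eq hPpath, zeta_eq hPpath, ← sum_symmDiff_singleton_add hnuv, ← hD,
        ← hI] at hle
      have h1 := sum_symmDiff_singleton_add (w := w) hBmem
      have hDB : {s(x, y)} ∆ ((P x).edges.toFinset ∆ B) = D := by
        rw [hB, symmDiff_left_comm (P x).edges.toFinset, symmDiff_symmDiff_cancel_left,
          symmDiff_symmDiff_cancel_left]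
      have hIB : ((P x).edges.toFinset ∩ B).erase s(x, y) = I := by
        ext f
        rw [Finset.mem_erase, Finset.mem_inter]
        by_cases hfD : f ∈ D
        · have hfI : f ∉ I := hID f hfD
          refine iff_of_false (fun h => ?_) hfI
          exact ((hBne f h.1).1 h.2.2).1 h.2.1 hfD
        · have hfe : f ≠ s(x, y) := fun h => hfD (h ▸ heD)
          rw [hBne f hfe, ← hx f hfD]
          simp [hfe, hfD]
      rw [hDB, hIB] at h1
      have hBy : (P y).edges.toFinset = B := by
        refine edges_eq_of_sum_le hcons hgen hPpath hPmin ?_ ?_ ?_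
        · intro f hf
          simp only [hB, Finset.mem_symmDiff, Finset.mem_singleton] at hf
          rcases hf with ⟨rfl, -⟩ | ⟨hf | hf, -⟩
          · exact hxy
          · exact mem_edgeSet_of_mem_toFinset_edges _ f hf.1
          · exact hDG f hf.1
        · rw [hB, parity_symmDiff, parity_symmDiff, hpe, parity_edges _ (hPpath x).isTrail, hDpar]
          have := zmodTwo_add_self (Pi.single x 1 : V → ZMod 2)
          linear_combination this
        · simp only [← hnxy, ← hBmem, and_self] at hle h1
          linarith
      intro f hf
      have hfe : f ≠ s(x, y) := fun h => hf (h ▸ heD)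
      rw [hBy, ← hx f hf, hBne f hfe]
      simp [hf]
    · have hK := edges_eq_symmDiff hcons hgen hPpath hPmin (x := x) (y := y) (x' := y) (y' := x)
        (K := {s(x, y)}) (fun e he => hDG e (Finset.mem_singleton.1 he ▸ heD)) (by
          rw [Finset.singleton_subset_iff, Finset.mem_symmDiff, List.mem_toFinset,
            List.mem_toFinset]
          have : ¬ (s(x, y) ∈ (P x).edges ↔ s(x, y) ∈ (P y).edges) := hxyn
          tauto)
        hpe (by rw [hpe, add_comm]) (Or.inr ⟨rfl, rfl⟩)
      intro f hf
      have hfe : f ≠ s(x, y) := fun h => hf (h ▸ heD)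
      rw [hK, ← hx f hf]
      simp [Finset.mem_symmDiff, hfe]

/-- A shortest path that meets the closed walk `C` splits at its last vertex on `C`, and the part
after it consists of the edges common to all shortest paths from `C`. -/
theorem exists_suffix_edges_eq (hcons : Conservative G w) (hgen : Generic G w)
    (hPpath : ∀ v, (P v).IsPath)
    (hPmin : ∀ (v : V) (Q : G.Walk v t), Q.IsPath → walkWeight w (P v) ≤ walkWeight w Q)
    {a : V} (C : G.Walk a a) {I : Finset (Sym2 V)}
    (hCI : ∀ e ∈ I, e ∉ C.edges)
    (hfam : ∀ y ∈ C.support, ∀ e ∉ C.edges, e ∈ (P y).edges.toFinset ↔ e ∈ I)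
    {x : V} (hx : x ∈ C.support) :
    ∃ (c : V) (A : G.Walk x c) (R : G.Walk c t), R.IsPath ∧ P x = A.append R ∧ c ∈ C.support ∧
      (∀ z ∈ R.support, z ∈ C.support → z = c) ∧ R.edges.toFinset = I := by
  obtain ⟨c, A, R, hAR, hc, hR⟩ := exists_suffix_meeting_once {z | z ∈ C.support} (P x)
    ⟨x, (P x).start_mem_support, hx⟩
  have hRpath : R.IsPath := (hAR ▸ hPpath x).of_append_right
  refine ⟨c, A, R, hRpath, hAR, hc, hR, ?_⟩
  have hRC : ∀ e ∈ R.edges, e ∉ C.edges := by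
    intro e he heC
    induction e using Sym2.ind with
    | h y z =>
      have hy := hR y (R.fst_mem_support_of_mem_edges he) (C.fst_mem_support_of_mem_edges heC)
      have hz := hR z (R.snd_mem_support_of_mem_edges he) (C.snd_mem_support_of_mem_edges heC)
      exact (R.adj_of_mem_edges he).ne (hy.trans hz.symm)
  have hRI : R.edges.toFinset ⊆ I := by
    intro e he
    have he' := List.mem_toFinset.1 he
    refine (hfam x hx e (hRC e he')).1 ?_
    rw [hAR, List.mem_toFinset, Walk.edges_append]
    exact List.mem_append_right _ he'
  have hIc : I ⊆ (P c).edges.toFinset := fun e he => (hfam c hc e (hCI e he)).2 he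
  have hsub := hRI.trans hIc
  have hnn := hcons.sum_nonneg ((P c).edges.toFinset \ R.edges.toFinset)
    (fun e he => mem_edgeSet_of_mem_toFinset_edges _ e (Finset.sdiff_subset he)) (by
      rw [parity_sdiff hsub, parity_edges _ (hPpath c).isTrail, parity_edges _ hRpath.isTrail,
        zmodTwo_add_self])
  have hsum := Finset.sum_sdiff (f := w) hsub
  have := edges_eq_of_sum_le hcons hgen hPpath hPmin (mem_edgeSet_of_mem_toFinset_edges R)
    (parity_edges R hRpath.isTrail) (by linarith)
  exact hRI.antisymm (this ▸ hIc)

end ShortestPaths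

theorem stmt10 {V : Type*} [Fintype V] [DecidableEq V] (G : SimpleGraph V)
    (hconn : G.Connected) (t : V) (w : Sym2 V → ℝ)
    (hcons : Conservative G w) (hgen : Generic G w)
    (P : ∀ v : V, G.Walk v t) (hPpath : ∀ v, (P v).IsPath)
    (hPmin : ∀ (v : V) (Q : G.Walk v t), Q.IsPath → walkWeight w (P v) ≤ walkWeight w Q)
    (hdeg : ∃! x : V, G.Adj t x)
    (u v : V) (huv : G.Adj u v) (hnd : NotInSymmDiff P u v)
    (hmin : zeta w P u v = zetaStar G t w P) :
    ∃ (c : V) (R : G.Walk c t) (Au : G.Walk u c) (Av : G.Walk v c),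
      R.IsPath ∧ P u = Au.append R ∧ P v = Av.append R ∧
      ({e | e ∈ (P u).edges ∧ e ∈ (P v).edges ∧ e ≠ s(u, v)} =
        {e | e ∈ R.edges}) ∧
      ∃ C : G.Walk c c, C.IsCycle ∧
        ({e | e ∈ C.edges} =
          {e | Xor' (e ∈ (P u).edges) (e ∈ (P v).edges)} ∪ {s(u, v)}) ∧
        ({x | x ∈ C.support} ∩ {x | x ∈ R.support} = {c}) := by
  obtain ⟨C, hC, hCD⟩ := exists_cycle_edges_eq hcons hgen hPpath hPmin huv hnd
  obtain ⟨I, hI⟩ : ∃ I, I = ((P u).edges.toFinset ∩ (P v).edges.toFinset).erase s(u, v) := ⟨_, rfl⟩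
  have hnd' : s(u, v) ∈ (P u).edges ↔ s(u, v) ∈ (P v).edges := hnd
  have hmemC : ∀ e, e ∈ C.edges ↔
      Xor (e ∈ (P u).edges) (e ∈ (P v).edges) ∨ e = s(u, v) := by
    intro e
    rw [← List.mem_toFinset, hCD]
    simp only [Finset.mem_symmDiff, Finset.mem_singleton, List.mem_toFinset, Xor]
    by_cases he : e = s(u, v)
    · subst he; tauto
    · tauto
  have hmemI : ∀ e, e ∈ I ↔ e ∈ (P u).edges ∧ e ∈ (P v).edges ∧ e ≠ s(u, v) := by
    intro e
    simp only [hI, Finset.mem_erase, Finset.mem_inter, List.mem_toFinset]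
    tauto
  have hCI : ∀ e ∈ I, e ∉ C.edges := by
    intro e he
    rw [hmemI] at he
    rw [hmemC, Xor]
    tauto
  have hfam : ∀ y ∈ C.support, ∀ e ∉ C.edges, e ∈ (P y).edges.toFinset ↔ e ∈ I := by
    have := mem_edges_iff_of_mem_support hcons hgen hPpath hPmin hnd hmin hCD
      (mem_edgeSet_of_mem_toFinset_edges C) (by rw [parity_edges C hC.isTrail, zmodTwo_add_self]) hI C
      (fun e he => List.mem_toFinset.2 he) (by
        intro e he
        rw [List.mem_toFinset, hmemC, Xor] at he
        rw [List.mem_toFinset, hmemI]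
        tauto)
    simpa only [List.mem_toFinset] using this
  have huC : u ∈ C.support := C.start_mem_support
  have hvC : v ∈ C.support :=
    C.snd_mem_support_of_mem_edges ((hmemC s(u, v)).2 (Or.inr rfl))
  obtain ⟨c, Au, R, hR, hAu, hcC, hRC, hRI⟩ :=
    exists_suffix_edges_eq hcons hgen hPpath hPmin C hCI hfam huC
  obtain ⟨c', Av, R', hR', hAv, -, -, hRI'⟩ :=
    exists_suffix_edges_eq hcons hgen hPpath hPmin C hCI hfam hvC
  have hcc : c = c' := by
    have h := parity_edges R hR.isTrail
    rw [hRI, ← hRI', parity_edges R' hR'.isTrail] at h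
    have h' := congrFun (add_right_cancel h) c
    by_contra hne
    simp [hne] at h'
  subst hcc
  have hRR : R' = R := hR'.eq_of_mem_edges_iff hR fun e => by
    rw [← List.mem_toFinset, hRI', ← hRI, List.mem_toFinset]
  subst hRR
  refine ⟨c, R', Au, Av, hR, hAu, hAv, ?_, C.rotate c hcC, hC.rotate hcC, ?_, ?_⟩
  · ext e
    rw [Set.mem_ofPred_eq, Set.mem_ofPred_eq, ← hmemI, ← hRI, List.mem_toFinset]
  · ext e
    rw [Set.mem_ofPred_eq, (C.rotate_edges c hcC).mem_iff, hmemC]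
    rfl
  · ext z
    simp only [Set.mem_inter_iff, Set.mem_ofPred_eq, Walk.mem_support_rotate_iff,
      Set.mem_singleton_iff]
    exact ⟨fun h => hRC z h.2 h.1, by rintro rfl; exact ⟨hcC, R'.start_mem_support⟩⟩
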